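/- arXiv:2410.22297 — 2 statements merged into one kernel-verified Lean document; each statement's English description precedes it below -/
import Mathlib

section
/- (One-epoch descent inequality for Ψ₀.) Under the NC assumptions, fix w̃_{t−1}, ũ_t ∈ dom L, a permutation π̂ of {1,…,n}, and η > 0. Let w₀ := w̃_{t−1}, w_i := w_{i−1} − (η/n)∇_wH_{π̂(i)}(w_{i−1}, ũ_t) for i = 1,…,n, g := (1/n)∑_{j=1}^n ∇_wH_{π̂(j)}(w_{j−1}, ũ_t) (so that w_n = w₀ − ηg), and w̃_t := prox_{ηf}(w_n). Then Ψ₀(w̃_t) ≤ Ψ₀(w̃_{t−1}) − ((1 − L_{Φ₀}η)/(2η))‖w̃_t − w̃_{t−1}‖² − (η(1 − 2L_{Φ₀}η)/2)‖G_η(w̃_{t−1})‖² + (η/2)‖g − ∇Φ₀(w̃_{t−1})‖². -/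
open RealInnerProductSpace Finset

theorem aux_prox {E : Type*} [NormedAddCommGroup E] [InnerProductSpace ℝ E]
    (f : E → ℝ) (hf : ConvexOn ℝ Set.univ f) (c : ℝ) (hc : 0 < c) (y v : E)
    (hy : ∀ z, f y + c * ‖y - v‖ ^ 2 ≤ f z + c * ‖z - v‖ ^ 2) (p : E) :
    f y ≤ f p + 2 * c * (inner ℝ (y - v) (p - y)) := by
  by_contra hcon
  push Not at hcon
  set A := f y - (f p + 2 * c * (inner ℝ (y - v) (p - y))) with hA
  have hApos : 0 < A := by linarith
  set B := c * ‖p - y‖ ^ 2 with hB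
  have hBn : 0 ≤ B := by positivity
  have key : ∀ t : ℝ, 0 < t → t ≤ 1 → A ≤ t * B := by
    intro t ht ht1
    have h1 := hy ((1 - t) • y + t • p)
    have h2 := hf.2 (Set.mem_univ y) (Set.mem_univ p) (by linarith : 0 ≤ 1 - t) ht.le (by ring)
    simp only [smul_eq_mul] at h2
    have h3 : (1 - t) • y + t • p - v = (y - v) + t • (p - y) := by module
    rw [h3, norm_add_sq_real, inner_smul_right, norm_smul, mul_pow, Real.norm_eq_abs, sq_abs] at h1
    have h4 : t * A ≤ t * (t * B) := by
      rw [hA, hB]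
      nlinarith
    exact le_of_mul_le_mul_left h4 ht
  have hAB : 0 < A + B := by linarith
  have h5 := key (A / (A + B)) (by positivity) (by rw [div_le_one hAB]; linarith)
  rw [div_mul_eq_mul_div, le_div_iff₀ hAB] at h5
  nlinarith

theorem aux_descent {E : Type*} [NormedAddCommGroup E] [InnerProductSpace ℝ E] [CompleteSpace E]
    (P : E → ℝ) (G : E → E) (L : ℝ) (hG : ∀ w, HasGradientAt P (G w) w)
    (hL : ∀ x y, ‖G x - G y‖ ≤ L * ‖x - y‖) (x y : E) :
    P y ≤ P x + (inner ℝ (G x) (y - x)) + L / 2 * ‖y - x‖ ^ 2 := by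
  set d := y - x with hd
  have hder : ∀ t : ℝ, HasDerivAt
      (fun t : ℝ => P (x + t • d) - t * (inner ℝ (G x) (d)) - t ^ 2 * (L / 2 * ‖d‖ ^ 2))
      ((inner ℝ (G (x + t • d)) (d)) - (inner ℝ (G x) (d)) - 2 * t * (L / 2 * ‖d‖ ^ 2)) t := by
    intro t
    have h1 : HasDerivAt (fun t : ℝ => x + t • d) d t := by
      simpa using ((hasDerivAt_id t).smul_const d).const_add x
    have h2 : HasDerivAt (fun t : ℝ => P (x + t • d)) (inner ℝ (G (x + t • d)) (d)) t := by
      have := (hG (x + t • d)).hasFDerivAt.comp_hasDerivAt t h1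
      simpa [Function.comp_def] using this
    have h3 : HasDerivAt (fun t : ℝ => t * (inner ℝ (G x) (d))) (inner ℝ (G x) (d)) t := by
      simpa using (hasDerivAt_id t).mul_const (inner ℝ (G x) (d))
    have h4 : HasDerivAt (fun t : ℝ => t ^ 2 * (L / 2 * ‖d‖ ^ 2)) (2 * t * (L / 2 * ‖d‖ ^ 2)) t := by
      simpa using (hasDerivAt_pow 2 t).mul_const (L / 2 * ‖d‖ ^ 2)
    exact (h2.sub h3).sub h4
  have hanti := antitoneOn_of_deriv_nonpos (convex_Icc (0:ℝ) 1)
    (fun t _ => (hder t).continuousAt.continuousWithinAt)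
    (fun t _ => (hder t).differentiableAt.differentiableWithinAt)
    (by
      intro t ht
      rw [interior_Icc] at ht
      rw [(hder t).deriv, ← inner_sub_left]
      have h1 := real_inner_le_norm (G (x + t • d) - G x) d
      have h2 := hL (x + t • d) x
      rw [add_sub_cancel_left, norm_smul, Real.norm_eq_abs, abs_of_pos ht.1] at h2
      have h3 := mul_le_mul_of_nonneg_right h2 (norm_nonneg d)
      nlinarith)
  have := hanti (Set.left_mem_Icc.2 zero_le_one) (Set.right_mem_Icc.2 zero_le_one) zero_le_one
  have hxy : x + d = y := by rw [hd]; abel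
  simp [hxy] at this
  linarith

/-- one-epoch descent inequality for `Ψ₀ = f + Φ₀`,
Lemma `le:SGM2_key_bounds_for_Phi_2`.  Under the NC assumptions, one shuffling
descent epoch from `w₀ := w̃_{t-1}` followed by `w̃_t := prox_{ηf}(w_n)`
satisfies
`Ψ₀(w̃_t) ≤ Ψ₀(w̃_{t-1}) - ((1-L_{Φ₀}η)/(2η))‖w̃_t-w̃_{t-1}‖²
  - (η(1-2L_{Φ₀}η)/2)‖G_η(w̃_{t-1})‖² + (η/2)‖g-∇Φ₀(w̃_{t-1})‖²`,
where `L_{Φ₀} = (1+κ)L_w`, `κ = L_u/(μ_H+μ_h)`. -/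
theorem one_epoch_descent_Psi0
    {E F : Type*} [NormedAddCommGroup E] [InnerProductSpace ℝ E] [CompleteSpace E]
    [NormedAddCommGroup F] [InnerProductSpace ℝ F] [CompleteSpace F]
    (n : ℕ) (hn : 0 < n)
    (Hi : Fin n → E → F → ℝ) (Gw : Fin n → E → F → E) (Gu : Fin n → E → F → F)
    (f : E → ℝ) (h : F → ℝ)
    (hf : ConvexOn ℝ Set.univ f)
    (μh μH Lw Lu : ℝ) (hμh : 0 ≤ μh) (hμH : 0 ≤ μH) (hμ : 0 < μH + μh)
    (hsch : StrongConvexOn Set.univ μh h)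
    (hscH : ∀ i w, StrongConcaveOn Set.univ μH (Hi i w))
    (hGw : ∀ i w u, HasGradientAt (fun w' => Hi i w' u) (Gw i w u) w)
    (hGu : ∀ i w u, HasGradientAt (fun u' => Hi i w u') (Gu i w u) u)
    (hLip : ∀ i w u w' u',
      ‖Gw i w u - Gw i w' u'‖ ^ 2 + ‖Gu i w u - Gu i w' u'‖ ^ 2 ≤
        Lw ^ 2 * ‖w - w'‖ ^ 2 + Lu ^ 2 * ‖u - u'‖ ^ 2)
    -- the value function `Φ₀`, its maximizer `u₀*`, and its gradient
    (ustar : E → F)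
    (hmax : ∀ w u, (n : ℝ)⁻¹ * ∑ i, Hi i w u - h u ≤
        (n : ℝ)⁻¹ * ∑ i, Hi i w (ustar w) - h (ustar w))
    (Phi0 : E → ℝ)
    (hPhi0 : ∀ w, Phi0 w = (n : ℝ)⁻¹ * ∑ i, Hi i w (ustar w) - h (ustar w))
    (gradPhi0 : E → E)
    (hgradeq : ∀ w, gradPhi0 w = (n : ℝ)⁻¹ • ∑ i, Gw i w (ustar w))
    (hgradPhi : ∀ w, HasGradientAt Phi0 (gradPhi0 w) w)
    (hLipPhi : ∀ x y, ‖gradPhi0 x - gradPhi0 y‖ ≤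
      (1 + Lu / (μH + μh)) * Lw * ‖x - y‖)
    -- the proximal operator of `η f`
    (η : ℝ) (hη : 0 < η)
    (prox : E → E)
    (hprox : ∀ x y, f (prox x) + (2 * η)⁻¹ * ‖prox x - x‖ ^ 2 ≤
        f y + (2 * η)⁻¹ * ‖y - x‖ ^ 2)
    -- one shuffling descent epoch from `w̃_{t-1}` with inexact `ũ_t`
    (wtprev : E) (util : F) (πh : Equiv.Perm (Fin n))
    (W : ℕ → E) (hW0 : W 0 = wtprev)
    (hrec : ∀ i : Fin n, W ((i : ℕ) + 1) = W (i : ℕ) - (η / n) • Gw (πh i) (W (i : ℕ)) util)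
    (g : E) (hg : g = (n : ℝ)⁻¹ • ∑ j : Fin n, Gw (πh j) (W (j : ℕ)) util)
    (wtnew : E) (hwt : wtnew = prox (W n))
    -- the gradient mapping `G_η(w̃_{t-1})`
    (Gmap : E)
    (hGmap : Gmap = η⁻¹ • (wtprev - prox (wtprev - η • gradPhi0 wtprev))) :
    f wtnew + Phi0 wtnew ≤
      f wtprev + Phi0 wtprev -
        (1 - (1 + Lu / (μH + μh)) * Lw * η) / (2 * η) * ‖wtnew - wtprev‖ ^ 2 -
        η * (1 - 2 * ((1 + Lu / (μH + μh)) * Lw) * η) / 2 * ‖Gmap‖ ^ 2 +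
        η / 2 * ‖g - gradPhi0 wtprev‖ ^ 2 := by
  have hWn : W n = wtprev - η • g := by
    have h1 : ∑ i ∈ range n, (W (i + 1) - W i) = W n - W 0 := sum_range_sub W n
    rw [Finset.sum_range] at h1
    have h2 : ∑ i : Fin n, (W ((i : ℕ) + 1) - W (i : ℕ)) = - (η • g) := by
      rw [hg, smul_smul, Finset.smul_sum, ← Finset.sum_neg_distrib]
      refine Finset.sum_congr rfl fun i _ => ?_
      rw [hrec i, div_eq_mul_inv]
      abel
    rw [h2, hW0] at h1
    rw [sub_eq_add_neg, h1]
    abel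
  set L := (1 + Lu / (μH + μh)) * Lw with hLdef
  set z := prox (wtprev - η • gradPhi0 wtprev) with hz
  have hc : 0 < (2 * η)⁻¹ := by positivity
  have e1 := aux_prox f hf _ hc (prox (W n)) (W n) (hprox (W n)) z
  have e2 := aux_prox f hf _ hc z (wtprev - η • gradPhi0 wtprev) (hprox _) wtprev
  have e3 := aux_descent Phi0 gradPhi0 L hgradPhi hLipPhi wtprev wtnew
  rw [← hwt, hWn] at e1
  have e4 : 0 ≤ L * ‖wtprev - z‖ ^ 2 := by
    have := (norm_nonneg _).trans (hLipPhi wtprev z)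
    have := mul_nonneg this (norm_nonneg (wtprev - z))
    nlinarith
  have hG2 : η ^ 2 * ‖Gmap‖ ^ 2 = ‖wtprev - z‖ ^ 2 := by
    rw [hGmap, norm_smul, mul_pow, norm_inv, inv_pow, Real.norm_eq_abs, sq_abs]
    field_simp
  -- vectors relative to the old point
  obtain ⟨a, ha⟩ : ∃ a, a = wtnew - wtprev := ⟨_, rfl⟩
  obtain ⟨b, hb⟩ : ∃ b, b = z - wtprev := ⟨_, rfl⟩
  set D := gradPhi0 wtprev with hD
  have r1 : wtnew - (wtprev - η • g) = a + η • g := by rw [ha]; abel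
  have r2 : z - wtnew = b - a := by rw [ha, hb]; abel
  have r3 : z - (wtprev - η • D) = b + η • D := by rw [hb]; abel
  have r4 : wtprev - z = -b := by rw [hb]; abel
  rw [r1, r2] at e1
  rw [r3, r4] at e2
  rw [← ha] at e3 ⊢
  rw [r4, norm_neg] at e4 hG2
  have e5 : 0 ≤ ‖η • (g - D) - (b - a)‖ ^ 2 := by positivity
  rw [norm_sub_sq_real, norm_sub_sq_real b a, norm_smul, mul_pow, Real.norm_eq_abs, sq_abs] at e5
  simp only [inner_add_left, inner_sub_left, inner_sub_right, inner_smul_left,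
    inner_neg_right, RCLike.conj_to_real, real_inner_self_eq_norm_sq] at e1 e2 e5
  rw [real_inner_comm b a] at e1
  have i1 : 2 * (2 * η)⁻¹ = η⁻¹ := by field_simp
  rw [i1] at e1 e2
  have m1 := mul_le_mul_of_nonneg_left e1 hη.le
  have m2 := mul_le_mul_of_nonneg_left e2 hη.le
  have m3 := mul_le_mul_of_nonneg_left e3 hη.le
  rw [mul_add, mul_inv_cancel_left₀ hη.ne'] at m1 m2
  refine le_of_mul_le_mul_left ?_ hη
  have m4 := mul_nonneg hη.le e4
  have e6 : η * (f wtprev + Phi0 wtprev - (1 - L * η) / (2 * η) * ‖a‖ ^ 2 -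
      η * (1 - 2 * L * η) / 2 * ‖Gmap‖ ^ 2 + η / 2 * ‖g - D‖ ^ 2) =
      η * (f wtprev + Phi0 wtprev) - (1 - L * η) / 2 * ‖a‖ ^ 2 -
      (1 - 2 * L * η) / 2 * (η ^ 2 * ‖Gmap‖ ^ 2) + η ^ 2 / 2 * ‖g - D‖ ^ 2 := by
    field_simp
  rw [e6, hG2]
  nlinarith
end

section
/- (Shuffling ascent epoch estimates.) Under the NC assumptions and the component-variance bound in u, fix w̃, ũ ∈ dom L, a permutation π of {1,…,n}, and a stepsize η̂ with 1 − 3L_u²η̂² ≥ 0. Define u₀ := ũ and u_i := u_{i−1} + (η̂/n)∇_uH_{π(i)}(w̃, u_{i−1}) for i = 1,…,n, and let v := (1/n)∑_{j=1}^n ∇_uH_{π(j)}(w̃, u_{j−1}). Then: (i) Δ̂ := (1/n)∑_{i=0}^{n−1}‖u_i − u₀‖² ≤ (3Θ_u+2)η̂²‖∇_uH(w̃,ũ)‖² + 3η̂²σ_u²; and (ii) ‖v − ∇_uH(w̃,ũ)‖² ≤ L_u²Δ̂. -/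
open RealInnerProductSpace Finset

lemma aux_norm_sum_sq {ι F : Type*} [SeminormedAddCommGroup F] (s : Finset ι) (x : ι → F) :
    ‖∑ i ∈ s, x i‖ ^ 2 ≤ (s.card : ℝ) * ∑ i ∈ s, ‖x i‖ ^ 2 :=
  (pow_le_pow_left₀ (norm_nonneg _) (norm_sum_le s x) 2).trans sq_sum_le_card_mul_sum_sq

lemma aux_three {F : Type*} [SeminormedAddCommGroup F] (x y z : F) :
    ‖x + y + z‖ ^ 2 ≤ 3 * (‖x‖ ^ 2 + ‖y‖ ^ 2 + ‖z‖ ^ 2) := by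
  have h : ‖x + y + z‖ ≤ ‖x‖ + ‖y‖ + ‖z‖ := norm_add₃_le
  have h2 := pow_le_pow_left₀ (norm_nonneg _) h 2
  nlinarith [sq_nonneg (‖x‖ - ‖y‖), sq_nonneg (‖x‖ - ‖z‖), sq_nonneg (‖y‖ - ‖z‖)]

lemma aux_sum1 (n : ℕ) : ∑ i ∈ Finset.range n, (i : ℝ) ≤ (n : ℝ) ^ 2 / 2 := by
  induction n with
  | zero => simp
  | succ k ih => rw [Finset.sum_range_succ]; push_cast; nlinarith

lemma aux_sum2 (n : ℕ) : ∑ i ∈ Finset.range n, (i : ℝ) ^ 2 ≤ (n : ℝ) ^ 3 / 3 := by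
  induction n with
  | zero => simp
  | succ k ih =>
    rw [Finset.sum_range_succ]; push_cast
    have : (0 : ℝ) ≤ k := Nat.cast_nonneg k
    nlinarith

lemma aux_core {F : Type*} [NormedAddCommGroup F] [InnerProductSpace ℝ F]
    (n : ℕ) (hn : 0 < n) (a b : ℕ → F) (G : F) (U : ℕ → F) (η L V D : ℝ)
    (hη : 1 - 3 * L ^ 2 * η ^ 2 ≥ 0)
    (hrec : ∀ i, i < n → U (i + 1) = U i + (η / n) • (a i + b i + G))
    (hD : ∑ i ∈ Finset.range n, ‖U i - U 0‖ ^ 2 = n * D)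
    (ha : ∑ i ∈ Finset.range n, ‖a i‖ ^ 2 ≤ L ^ 2 * (n * D))
    (hb : ∑ i ∈ Finset.range n, ‖b i‖ ^ 2 ≤ n * V) :
    D ≤ 3 * η ^ 2 * V + 2 * η ^ 2 * ‖G‖ ^ 2 := by
  have hn' : (0 : ℝ) < n := by exact_mod_cast hn
  have hU : ∀ i, i ≤ n → U i - U 0 = (η / n) • (∑ j ∈ Finset.range i, a j
      + ∑ j ∈ Finset.range i, b j + (i : ℝ) • G) := by
    intro i
    induction i with
    | zero => simp
    | succ k ih =>
      intro hk
      have := ih (by omega)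
      rw [hrec k (by omega), add_sub_right_comm, this, Finset.sum_range_succ,
        Finset.sum_range_succ]
      push_cast
      module
  have hpt : ∀ i ∈ Finset.range n, ‖U i - U 0‖ ^ 2 ≤
      (3 * η ^ 2 / n ^ 2) * ((i : ℝ) * (L ^ 2 * (n * D) + n * V) + (i : ℝ) ^ 2 * ‖G‖ ^ 2) := by
    intro i hi
    have hi' := Finset.mem_range.1 hi
    rw [hU i hi'.le, norm_smul, mul_pow, Real.norm_eq_abs, sq_abs]
    have h3 := aux_three (∑ j ∈ Finset.range i, a j) (∑ j ∈ Finset.range i, b j) ((i : ℝ) • G)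
    have h1 := aux_norm_sum_sq (Finset.range i) a
    have h2 := aux_norm_sum_sq (Finset.range i) b
    have hsub : Finset.range i ⊆ Finset.range n := Finset.range_subset_range.2 hi'.le
    have m1 : ∑ j ∈ Finset.range i, ‖a j‖ ^ 2 ≤ L ^ 2 * (n * D) :=
      (Finset.sum_le_sum_of_subset_of_nonneg hsub (fun _ _ _ => by positivity)).trans ha
    have m2 : ∑ j ∈ Finset.range i, ‖b j‖ ^ 2 ≤ n * V :=
      (Finset.sum_le_sum_of_subset_of_nonneg hsub (fun _ _ _ => by positivity)).trans hb
    rw [Finset.card_range] at h1 h2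
    have h0 : (0 : ℝ) ≤ i := Nat.cast_nonneg i
    have k1 := mul_le_mul_of_nonneg_left m1 h0
    have k2 := mul_le_mul_of_nonneg_left m2 h0
    have h4 : ‖(i : ℝ) • G‖ ^ 2 = (i : ℝ) ^ 2 * ‖G‖ ^ 2 := by
      rw [norm_smul, mul_pow, Real.norm_eq_abs, sq_abs]
    rw [h4] at h3
    have e : (3 * η ^ 2 / n ^ 2) * ((i : ℝ) * (L ^ 2 * (n * D) + n * V) + (i : ℝ) ^ 2 * ‖G‖ ^ 2)
      = (η / n) ^ 2 * (3 * ((i : ℝ) * (L ^ 2 * (n * D) + n * V) + (i : ℝ) ^ 2 * ‖G‖ ^ 2)) := by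
      ring
    rw [e]
    apply mul_le_mul_of_nonneg_left _ (sq_nonneg _)
    linarith
  have hs := Finset.sum_le_sum hpt
  rw [hD, ← Finset.mul_sum, Finset.sum_add_distrib, ← Finset.sum_mul, ← Finset.sum_mul] at hs
  have hA : 0 ≤ L ^ 2 * (n * D) + n * V :=
    add_nonneg ((Finset.sum_nonneg (fun _ _ => by positivity)).trans ha)
      ((Finset.sum_nonneg (fun _ _ => by positivity)).trans hb)
  have hD0 : 0 ≤ D := by
    have : 0 ≤ (n : ℝ) * D := hD ▸ Finset.sum_nonneg (fun _ _ => by positivity)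
    exact nonneg_of_mul_nonneg_right this hn'
  have hs2 : n * D ≤ (3 * η ^ 2 / n ^ 2) * ((n : ℝ) ^ 2 / 2 * (L ^ 2 * (n * D) + n * V)
      + (n : ℝ) ^ 3 / 3 * ‖G‖ ^ 2) := by
    refine hs.trans (mul_le_mul_of_nonneg_left ?_ (by positivity))
    exact add_le_add (mul_le_mul_of_nonneg_right (aux_sum1 n) hA)
      (mul_le_mul_of_nonneg_right (aux_sum2 n) (by positivity))
  have e : (3 * η ^ 2 / n ^ 2) * ((n : ℝ) ^ 2 / 2 * (L ^ 2 * (n * D) + n * V)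
      + (n : ℝ) ^ 3 / 3 * ‖G‖ ^ 2) = n * (3 / 2 * η ^ 2 * L ^ 2 * D + 3 / 2 * η ^ 2 * V
        + η ^ 2 * ‖G‖ ^ 2) := by
    field_simp
  rw [e] at hs2
  have hs3 := le_of_mul_le_mul_left hs2 hn'
  nlinarith [mul_nonneg hη hD0]

/-- estimates for one shuffling ascent epoch in `u`,
Lemma `le:SGM3_key_bounds_for_ut_2`.  Under the NC assumptions and the
component-variance bound in `u`, one shuffling ascent epoch
`u_i := u_{i-1} + (η̂/n) ∇_u H_{π(i)}(w̃, u_{i-1})` from `u₀ = ũ` with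
`1 - 3L_u²η̂² ≥ 0` satisfies
(i) `Δ̂ ≤ (3Θ_u+2)η̂²‖∇_uH(w̃,ũ)‖² + 3η̂²σ_u²` and
(ii) `‖v - ∇_uH(w̃,ũ)‖² ≤ L_u²Δ̂`. -/
theorem shuffling_ascent_epoch_estimates
    {E F : Type*} [NormedAddCommGroup E] [InnerProductSpace ℝ E] [CompleteSpace E]
    [NormedAddCommGroup F] [InnerProductSpace ℝ F] [CompleteSpace F]
    (n : ℕ) (hn : 0 < n)
    (Hi : Fin n → E → F → ℝ) (Gw : Fin n → E → F → E) (Gu : Fin n → E → F → F)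
    (Lw Lu : ℝ)
    (hGw : ∀ i w u, HasGradientAt (fun w' => Hi i w' u) (Gw i w u) w)
    (hGu : ∀ i w u, HasGradientAt (fun u' => Hi i w u') (Gu i w u) u)
    (hLip : ∀ i w u w' u',
      ‖Gw i w u - Gw i w' u'‖ ^ 2 + ‖Gu i w u - Gu i w' u'‖ ^ 2 ≤
        Lw ^ 2 * ‖w - w'‖ ^ 2 + Lu ^ 2 * ‖u - u'‖ ^ 2)
    -- component-variance bound in `u`
    (Θu σu : ℝ) (hΘu : 0 ≤ Θu) (hσu : 0 ≤ σu)
    (hvaru : ∀ w u, (n : ℝ)⁻¹ * ∑ i, ‖Gu i w u - (n : ℝ)⁻¹ • ∑ j, Gu j w u‖ ^ 2 ≤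
        Θu * ‖(n : ℝ)⁻¹ • ∑ j, Gu j w u‖ ^ 2 + σu ^ 2)
    -- the data of one shuffling ascent epoch
    (wtil : E) (util : F) (π : Equiv.Perm (Fin n))
    (ηh : ℝ) (hηh : 0 < ηh) (hηc : 1 - 3 * Lu ^ 2 * ηh ^ 2 ≥ 0)
    (U : ℕ → F) (hU0 : U 0 = util)
    (hrec : ∀ i : Fin n, U ((i : ℕ) + 1) = U (i : ℕ) + (ηh / n) • Gu (π i) wtil (U (i : ℕ)))
    (v : F) (hv : v = (n : ℝ)⁻¹ • ∑ j : Fin n, Gu (π j) wtil (U (j : ℕ)))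
    (Δh : ℝ) (hΔh : Δh = (n : ℝ)⁻¹ * ∑ i : Fin n, ‖U (i : ℕ) - U 0‖ ^ 2) :
    -- (i)
    Δh ≤ (3 * Θu + 2) * ηh ^ 2 * ‖(n : ℝ)⁻¹ • ∑ j, Gu j wtil util‖ ^ 2 +
        3 * ηh ^ 2 * σu ^ 2 ∧
    -- (ii)
    ‖v - (n : ℝ)⁻¹ • ∑ j, Gu j wtil util‖ ^ 2 ≤ Lu ^ 2 * Δh := by
  have hn' : (0 : ℝ) < n := by exact_mod_cast hn
  have hnD : ∑ i : Fin n, ‖U (i : ℕ) - U 0‖ ^ 2 = n * Δh := by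
    rw [hΔh]; field_simp
  set G : F := (n : ℝ)⁻¹ • ∑ j, Gu j wtil util with hG
  have hl : ∀ i : Fin n, ‖Gu (π i) wtil (U i) - Gu (π i) wtil util‖ ^ 2 ≤
      Lu ^ 2 * ‖U i - U 0‖ ^ 2 := by
    intro i
    have := hLip (π i) wtil (U i) wtil util
    rw [hU0]
    simp only [sub_self, norm_zero] at this
    nlinarith [sq_nonneg ‖Gw (π i) wtil (U i) - Gw (π i) wtil util‖]
  have hls : ∑ i : Fin n, ‖Gu (π i) wtil (U i) - Gu (π i) wtil util‖ ^ 2 ≤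
      Lu ^ 2 * (n * Δh) := by
    rw [← hnD, Finset.mul_sum]
    exact Finset.sum_le_sum fun i _ => hl i
  constructor
  · have hb : ∑ i : Fin n, ‖Gu (π i) wtil util - G‖ ^ 2 ≤ n * (Θu * ‖G‖ ^ 2 + σu ^ 2) := by
      rw [Equiv.sum_comp π (fun i => ‖Gu i wtil util - G‖ ^ 2)]
      have := hvaru wtil util
      rwa [← hG, inv_mul_le_iff₀ hn'] at this
    have key := aux_core n hn
      (fun k => if h : k < n then Gu (π ⟨k, h⟩) wtil (U k) - Gu (π ⟨k, h⟩) wtil util else 0)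
      (fun k => if h : k < n then Gu (π ⟨k, h⟩) wtil util - G else 0)
      G U ηh Lu (Θu * ‖G‖ ^ 2 + σu ^ 2) Δh hηc
      (by
        intro i hi
        have := hrec ⟨i, hi⟩
        simp only [hi, dif_pos, sub_add_sub_cancel, sub_add_cancel]
        exact this)
      (by rw [← hnD, ← Fin.sum_univ_eq_sum_range (fun i => ‖U i - U 0‖ ^ 2)])
      (by
        rw [← Fin.sum_univ_eq_sum_range (fun k => ‖(if h : k < n then
          Gu (π ⟨k, h⟩) wtil (U k) - Gu (π ⟨k, h⟩) wtil util else 0 : F)‖ ^ 2)]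
        simpa using hls)
      (by
        rw [← Fin.sum_univ_eq_sum_range (fun k => ‖(if h : k < n then
          Gu (π ⟨k, h⟩) wtil util - G else 0 : F)‖ ^ 2)]
        simpa using hb)
    linarith
  · have e : v - G = (n : ℝ)⁻¹ • ∑ j : Fin n,
        (Gu (π j) wtil (U j) - Gu (π j) wtil util) := by
      rw [hv, hG, Finset.sum_sub_distrib, smul_sub, Equiv.sum_comp π (fun i => Gu i wtil util)]
    rw [e, norm_smul, mul_pow, Real.norm_eq_abs, sq_abs]
    have h := aux_norm_sum_sq Finset.univ
      (fun j : Fin n => Gu (π j) wtil (U j) - Gu (π j) wtil util)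
    rw [Finset.card_univ, Fintype.card_fin] at h
    have h2 := h.trans (mul_le_mul_of_nonneg_left hls hn'.le)
    refine (mul_le_mul_of_nonneg_left h2 (sq_nonneg _)).trans (le_of_eq ?_)
    field_simp
end
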